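/- arXiv:1309.6966 — 8 statements merged into one kernel-verified Lean document; each statement's English description precedes it below -/
import Mathlib

section
/- Let R be a commutative ring and L ⊆ M an inclusion of R-modules. For any two surjections p : F ↠ M and π : G ↠ M from free R-modules F and G, one has p((p⁻¹(L))⁻_F) = π((π⁻¹(L))⁻_G); that is, the liftable integral closure of L in M is independent of the choice of free module surjecting onto M. -/
/- # Liftable integral closure: core definitions

Free $R$-modules are modeled as `ι →₀ R`, and the symmetric algebra of `ι →₀ R`
is modeled as `MvPolynomial ι R`, with the canonical degree-one embedding sending
the basis vector at `i` to the variable `X i`. -/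

noncomputable section

open scoped TensorProduct

namespace LIC

variable (R : Type*) [CommRing R]

/-- The canonical embedding of the free module `ι →₀ R` onto the degree-one part of its
symmetric algebra `MvPolynomial ι R`. -/
def symEmb (ι : Type*) : (ι →₀ R) →ₗ[R] MvPolynomial ι R :=
  Finsupp.linearCombination R MvPolynomial.X

variable {R}

/-- The integral closure `U⁻_F` of a submodule `U` of the free module `F = ι →₀ R`:
the degree-one part of the integral closure, inside the symmetric algebra of `F`,
of the subalgebra generated by `U`. -/
def freeIC {ι : Type*} (U : Submodule R (ι →₀ R)) : Submodule R (ι →₀ R) where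
  carrier := {x | IsIntegral (Algebra.adjoin R (symEmb R ι '' U)) (symEmb R ι x)}
  zero_mem' := by simpa using isIntegral_zero
  add_mem' := by
    intro a b ha hb
    simpa [map_add] using ha.add hb
  smul_mem' := by
    intro c x hx
    have hc : IsIntegral (Algebra.adjoin R (symEmb R ι '' ↑U))
        ((algebraMap R (MvPolynomial ι R)) c) := by
      have : (algebraMap R (MvPolynomial ι R)) c
          = algebraMap (Algebra.adjoin R (symEmb R ι '' ↑U)) (MvPolynomial ι R)
            ⟨(algebraMap R (MvPolynomial ι R)) c,
              Subalgebra.algebraMap_mem _ c⟩ := rfl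
      rw [this]
      exact isIntegral_algebraMap
    have : symEmb R ι (c • x) = (algebraMap R (MvPolynomial ι R)) c * symEmb R ι x := by
      rw [map_smul, Algebra.smul_def]
    simpa [Set.mem_setOf_eq, this] using hc.mul hx
  
/-- The liftable integral closure `lic(L, M)` of a submodule `L ⊆ M`, computed via the
canonical free presentation `M →₀ R ↠ M`.  (By `LIC.lic_indep` this agrees with the
closure computed from any surjection of a free module onto `M`.) -/
def lic {M : Type*} [AddCommGroup M] [Module R M] (L : Submodule R M) : Submodule R M :=
  Submodule.map (Finsupp.linearCombination R (id : M → M))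
    (freeIC (Submodule.comap (Finsupp.linearCombination R (id : M → M)) L))

end LIC

end

/-- Functoriality of the integral closure for maps of free modules. -/
theorem LIC.freeIC_map_mem {R : Type*} [CommRing R] {ι κ : Type*}
    (f : (ι →₀ R) →ₗ[R] (κ →₀ R)) (U : Submodule R (ι →₀ R)) (V : Submodule R (κ →₀ R))
    (hUV : ∀ x ∈ U, f x ∈ V) (x : ι →₀ R) (hx : x ∈ LIC.freeIC U) :
    f x ∈ LIC.freeIC V := by
  let φ : MvPolynomial ι R →ₐ[R] MvPolynomial κ R :=
    MvPolynomial.aeval (fun i => LIC.symEmb R κ (f (Finsupp.single i 1)))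
  have hφ : ∀ y, φ (LIC.symEmb R ι y) = LIC.symEmb R κ (f y) := by
    intro y
    have h : φ.toLinearMap ∘ₗ LIC.symEmb R ι = LIC.symEmb R κ ∘ₗ f := by
      ext i : 2
      simp [φ, LIC.symEmb]
    exact LinearMap.congr_fun h y
  have hle : Algebra.adjoin R (LIC.symEmb R ι '' U) ≤
      (Algebra.adjoin R (LIC.symEmb R κ '' V)).comap φ := by
    rw [Algebra.adjoin_le_iff]
    rintro _ ⟨u, hu, rfl⟩
    change φ (LIC.symEmb R ι u) ∈ Algebra.adjoin R (LIC.symEmb R κ '' V)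
    rw [hφ]
    exact Algebra.subset_adjoin ⟨f u, hUV u hu, rfl⟩
  let ψ : Algebra.adjoin R (LIC.symEmb R ι '' U) →ₐ[R]
      Algebra.adjoin R (LIC.symEmb R κ '' V) :=
    (φ.comp (Subalgebra.val _)).codRestrict _ (fun a => hle a.2)
  have hx' : IsIntegral (Algebra.adjoin R (LIC.symEmb R ι '' U)) (LIC.symEmb R ι x) := hx
  have := hx'.map_of_comp_eq ψ.toRingHom φ.toRingHom (RingHom.ext fun a => rfl)
  change IsIntegral (Algebra.adjoin R (LIC.symEmb R κ '' V)) (LIC.symEmb R κ (f x))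
  rw [← hφ]
  exact this

/-- One inclusion of the independence statement. -/
theorem LIC.map_freeIC_le {R : Type*} [CommRing R]
    {M : Type*} [AddCommGroup M] [Module R M] (L : Submodule R M)
    {ι κ : Type*} (p : (ι →₀ R) →ₗ[R] M) (π : (κ →₀ R) →ₗ[R] M)
    (hπ : Function.Surjective π) :
    Submodule.map p (LIC.freeIC (Submodule.comap p L)) ≤
      Submodule.map π (LIC.freeIC (Submodule.comap π L)) := by
  obtain ⟨f, hf⟩ := Module.projective_lifting_property π p hπ
  have hf' : ∀ x, π (f x) = p x := fun x => LinearMap.congr_fun hf x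
  rintro _ ⟨x, hx, rfl⟩
  refine ⟨f x, LIC.freeIC_map_mem f _ _ ?_ x hx, hf' x⟩
  intro y hy
  simpa [hf'] using hy

/-- The liftable integral closure is independent of the chosen
surjection from a free module: for any two surjections `p : F ↠ M`, `π : G ↠ M`
from free modules, `p((p⁻¹ L)⁻_F) = π((π⁻¹ L)⁻_G)`. -/
theorem lic_independent_of_presentation {R : Type*} [CommRing R]
    {M : Type*} [AddCommGroup M] [Module R M] (L : Submodule R M)
    {ι κ : Type*} (p : (ι →₀ R) →ₗ[R] M) (π : (κ →₀ R) →ₗ[R] M)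
    (hp : Function.Surjective p) (hπ : Function.Surjective π) :
    Submodule.map p (LIC.freeIC (Submodule.comap p L)) =
      Submodule.map π (LIC.freeIC (Submodule.comap π L)) := by
  exact le_antisymm (LIC.map_freeIC_le L p π hπ) (LIC.map_freeIC_le L π p hp)
end

section
/- (Reduction lemma.) Let R be a commutative ring, Λ any index set, L ⊆ M R-modules, and suppose given families of submodules {L_λ}_{λ∈Λ} and {M_λ}_{λ∈Λ} of M such that M = Σ_{λ∈Λ} M_λ, L = Σ_{λ∈Λ} L_λ, and L_λ ⊆ L ∩ M_λ for each λ. Then lic(L, M) equals the union, over all finite subsets σ ⊆ Λ, of lic(Σ_{λ∈σ} L_λ, Σ_{λ∈σ} M_λ). -/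
namespace LIC

lemma freeIC_map {R : Type*} [CommRing R] {ι κ : Type*} (f : (ι →₀ R) →ₗ[R] (κ →₀ R))
    (U : Submodule R (ι →₀ R)) (V : Submodule R (κ →₀ R)) (h : ∀ u ∈ U, f u ∈ V)
    {x : ι →₀ R} (hx : x ∈ freeIC U) : f x ∈ freeIC V := by
  let ψ : MvPolynomial ι R →ₐ[R] MvPolynomial κ R :=
    MvPolynomial.aeval (fun i => symEmb R κ (f (Finsupp.single i 1)))
  have hψ : ∀ y, ψ (symEmb R ι y) = symEmb R κ (f y) := by
    intro y
    have : ψ.toLinearMap ∘ₗ symEmb R ι = symEmb R κ ∘ₗ f := by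
      refine Finsupp.lhom_ext' fun i => LinearMap.ext_ring ?_
      simp [ψ, symEmb]
    exact LinearMap.congr_fun this y
  have hA : Algebra.adjoin R (symEmb R ι '' U) ≤
      (Algebra.adjoin R (symEmb R κ '' V)).comap ψ := by
    rw [Algebra.adjoin_le_iff]
    rintro _ ⟨u, hu, rfl⟩
    change ψ _ ∈ Algebra.adjoin R (symEmb R κ '' (V : Set (κ →₀ R)))
    rw [hψ]
    exact Algebra.subset_adjoin ⟨_, h u hu, rfl⟩
  let φ := (ψ.comp (Algebra.adjoin R (symEmb R ι '' (U : Set (ι →₀ R)))).val).codRestrict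
    (Algebra.adjoin R (symEmb R κ '' (V : Set (κ →₀ R)))) (fun a => hA a.2)
  change IsIntegral _ _
  rw [← hψ]
  exact IsIntegral.map_of_comp_eq φ.toRingHom ψ.toRingHom (by ext <;> rfl) hx

lemma exists_finset_adjoin {R A : Type*} [CommRing R] [CommRing A] [Algebra R A] (S : Set A)
    {a : A} (ha : a ∈ Algebra.adjoin R S) :
    ∃ T : Finset A, (T : Set A) ⊆ S ∧ a ∈ Algebra.adjoin R (T : Set A) := by
  classical
  induction ha using Algebra.adjoin_induction with
  | mem x hx => exact ⟨{x}, by simpa using hx, Algebra.subset_adjoin (by simp)⟩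
  | algebraMap r => exact ⟨∅, by simp, Subalgebra.algebraMap_mem _ r⟩
  | add x y _ _ hx hy =>
    obtain ⟨T, hT, h1⟩ := hx
    obtain ⟨T', hT', h2⟩ := hy
    refine ⟨T ∪ T', by simp [hT, hT'], add_mem ?_ ?_⟩
    · exact Algebra.adjoin_mono (by simp) h1
    · exact Algebra.adjoin_mono (by simp) h2
  | mul x y _ _ hx hy =>
    obtain ⟨T, hT, h1⟩ := hx
    obtain ⟨T', hT', h2⟩ := hy
    refine ⟨T ∪ T', by simp [hT, hT'], mul_mem ?_ ?_⟩
    · exact Algebra.adjoin_mono (by simp) h1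
    · exact Algebra.adjoin_mono (by simp) h2

lemma exists_finset_isIntegral {R A : Type*} [CommRing R] [CommRing A] [Algebra R A] (S : Set A)
    {a : A} (ha : IsIntegral (Algebra.adjoin R S) a) :
    ∃ T : Finset A, (T : Set A) ⊆ S ∧ IsIntegral (Algebra.adjoin R (T : Set A)) a := by
  classical
  obtain ⟨p, hp, hpa⟩ := ha
  choose T hTS hT using fun b : Algebra.adjoin R S => exists_finset_adjoin S b.2
  let T0 := p.coeffs.biUnion T
  let q : Polynomial A := p.map (algebraMap (Algebra.adjoin R S) A)
  have hq : (q.coeffs : Set A) ⊆ (Algebra.adjoin R (T0 : Set A)).toSubring := by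
    intro c hc
    obtain ⟨n, hn, rfl⟩ := Polynomial.mem_coeffs_iff.1 (Finset.mem_coe.1 hc)
    have hn' : p.coeff n ≠ 0 := by
      intro h0
      simp [q, h0] at hn
    have h1 : p.coeff n ∈ p.coeffs := Polynomial.coeff_mem_coeffs hn'
    rw [Polynomial.coeff_map]
    refine Algebra.adjoin_mono ?_ (hT (p.coeff n))
    intro t ht
    exact Finset.mem_coe.2 (Finset.mem_biUnion.2 ⟨_, h1, ht⟩)
  refine ⟨T0, ?_, q.toSubring _ hq, ?_, ?_⟩
  · intro t ht
    obtain ⟨b, _, hb⟩ := Finset.mem_biUnion.1 (Finset.mem_coe.1 ht)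
    exact hTS b hb
  · exact (Polynomial.monic_toSubring q _ hq).2 (hp.map _)
  · have h2 : (q.toSubring _ hq).map (Subring.subtype _) = q := by
      ext n
      rw [Polynomial.coeff_map]
      exact Polynomial.coeff_toSubring q _ hq
    have h3 : q.eval a = 0 := by
      rw [Polynomial.eval_map]; exact hpa
    rw [← h2, Polynomial.eval_map] at h3
    exact h3

lemma exists_finset_iSup {R M Λ : Type*} [CommRing R] [AddCommGroup M] [Module R M]
    (p : Λ → Submodule R M) (T : Finset M) (hT : ∀ t ∈ T, t ∈ ⨆ i, p i) :
    ∃ σ : Finset Λ, ∀ t ∈ T, t ∈ ⨆ i ∈ σ, p i := by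
  classical
  induction T using Finset.induction_on with
  | empty => exact ⟨∅, by simp⟩
  | insert a T _ ih =>
    obtain ⟨σ, hσ⟩ := ih fun t ht => hT t (Finset.mem_insert_of_mem ht)
    obtain ⟨τ, hτ⟩ := (Submodule.mem_iSup_iff_exists_finset).1 (hT a (Finset.mem_insert_self _ _))
    refine ⟨σ ∪ τ, fun t ht => ?_⟩
    rcases Finset.mem_insert.1 ht with rfl | ht
    · have hle : (⨆ i ∈ τ, p i) ≤ ⨆ i ∈ σ ∪ τ, p i :=
        biSup_mono (fun i hi => Finset.mem_union_right _ hi)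
      exact hle hτ
    · have hle : (⨆ i ∈ σ, p i) ≤ ⨆ i ∈ σ ∪ τ, p i :=
        biSup_mono (fun i hi => Finset.mem_union_left _ hi)
      exact hle (hσ t ht)

end LIC

/-- **Reduction lemma.** Let `L ⊆ M` and suppose `{L i}`, `{M i}` are
families of submodules of `M` with `M = Σ M i`, `L = Σ L i` and `L i ⊆ L ∩ M i` for all
`i`.  Then `lic(L, M)` is the union, over finite subsets `σ` of the index set, of
`lic(Σ_{i ∈ σ} L i, Σ_{i ∈ σ} M i)`, each viewed inside `M` via the inclusion
`Σ_{i ∈ σ} M i ⊆ M`. -/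
theorem lic_reduction {R : Type*} [CommRing R] {M : Type*} [AddCommGroup M] [Module R M]
    {Λ : Type*} (Mfam Lfam : Λ → Submodule R M) (L : Submodule R M)
    (hM : (⨆ i, Mfam i) = ⊤) (hL : (⨆ i, Lfam i) = L)
    (hLM : ∀ i, Lfam i ≤ L ⊓ Mfam i) :
    (LIC.lic L : Set M) =
      ⋃ σ : Finset Λ,
        ↑(Submodule.map (⨆ i ∈ σ, Mfam i).subtype
          (LIC.lic (Submodule.comap (⨆ i ∈ σ, Mfam i).subtype (⨆ i ∈ σ, Lfam i)))) := by
  classical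
  ext m
  simp only [Set.mem_iUnion, SetLike.mem_coe]
  constructor
  · rintro ⟨x, hx, rfl⟩
    obtain ⟨T, hTS, hT⟩ := LIC.exists_finset_isIntegral _ hx
    obtain ⟨T', hT'K, rfl⟩ := Finset.subset_set_image_iff.1 hTS
    obtain ⟨σ₁, h₁⟩ := LIC.exists_finset_iSup Mfam (x.support ∪ T'.biUnion Finsupp.support)
      (fun t _ => by rw [hM]; trivial)
    obtain ⟨σ₂, h₂⟩ := LIC.exists_finset_iSup Lfam
      (T'.image (Finsupp.linearCombination R (id : M → M))) (fun t ht => by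
        obtain ⟨u, hu, rfl⟩ := Finset.mem_image.1 ht
        rw [hL]
        exact hT'K hu)
    refine ⟨σ₁ ∪ σ₂, ?_⟩
    have hN : (⨆ i ∈ σ₁, Mfam i) ≤ ⨆ i ∈ σ₁ ∪ σ₂, Mfam i :=
      biSup_mono (fun i hi => Finset.mem_union_left _ hi)
    have hLs : (⨆ i ∈ σ₂, Lfam i) ≤ ⨆ i ∈ σ₁ ∪ σ₂, Lfam i :=
      biSup_mono (fun i hi => Finset.mem_union_right _ hi)
    generalize hNdef : (⨆ i ∈ σ₁ ∪ σ₂, Mfam i) = N at *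
    let r : (M →₀ R) →ₗ[R] (N →₀ R) := Finsupp.lcomapDomain _ N.subtype_injective
    have hr : ∀ u : M →₀ R, (∀ t ∈ u.support, t ∈ N) →
        N.subtype (Finsupp.linearCombination R (id : N → N) (r u)) =
          Finsupp.linearCombination R (id : M → M) u := by
      intro u hu
      have h3 : Finsupp.mapDomain N.subtype (r u) = u :=
        Finsupp.mapDomain_comapDomain _ N.subtype_injective u (by
          intro t ht
          exact ⟨⟨t, hu t ht⟩, rfl⟩)
      conv_rhs => rw [← h3, Finsupp.linearCombination_mapDomain]
      rw [Finsupp.apply_linearCombination]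
      rfl
    have hx' : x ∈ LIC.freeIC (Submodule.span R (T' : Set (M →₀ R))) := by
      have hle : Algebra.adjoin R ((T'.image (LIC.symEmb R M) : Finset _) : Set (MvPolynomial M R))
          ≤ Algebra.adjoin R (LIC.symEmb R M '' (Submodule.span R (T' : Set (M →₀ R)))) := by
        apply Algebra.adjoin_mono
        rw [Finset.coe_image]
        exact Set.image_mono Submodule.subset_span
      exact IsIntegral.map_of_comp_eq (Subalgebra.inclusion hle).toRingHom (RingHom.id _)
        (by ext <;> rfl) hT
    refine ⟨Finsupp.linearCombination R (id : N → N) (r x), ⟨r x, ?_, rfl⟩, ?_⟩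
    · refine LIC.freeIC_map r _ _ ?_ hx'
      suffices Submodule.span R (T' : Set (M →₀ R)) ≤ Submodule.comap r
        (Submodule.comap (Finsupp.linearCombination R (id : N → N))
          (Submodule.comap N.subtype (⨆ i ∈ σ₁ ∪ σ₂, Lfam i))) from fun u hu => this hu
      rw [Submodule.span_le]
      intro u hu
      change N.subtype (Finsupp.linearCombination R (id : N → N) (r u)) ∈ ⨆ i ∈ σ₁ ∪ σ₂, Lfam i
      rw [hr u (fun t ht => hN (h₁ t (Finset.mem_union_right _
        (Finset.mem_biUnion.2 ⟨u, hu, ht⟩))))]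
      exact hLs (h₂ _ (Finset.mem_image_of_mem _ hu))
    · exact hr x (fun t ht => hN (h₁ t (Finset.mem_union_left _ ht)))
  · rintro ⟨σ, _, ⟨x, hx, rfl⟩, rfl⟩
    have hLs : (⨆ i ∈ σ, Lfam i) ≤ L := iSup₂_le fun i _ => (hLM i).trans inf_le_left
    generalize (⨆ i ∈ σ, Mfam i) = N at *
    have hr : ∀ u : N →₀ R, Finsupp.linearCombination R (id : M → M)
        (Finsupp.lmapDomain R R N.subtype u) =
          N.subtype (Finsupp.linearCombination R (id : N → N) u) := by
      intro u
      rw [Finsupp.lmapDomain_apply, Finsupp.linearCombination_mapDomain,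
        Finsupp.apply_linearCombination]
      rfl
    refine ⟨Finsupp.lmapDomain R R N.subtype x, LIC.freeIC_map _ _ _ ?_ hx, hr x⟩
    intro u hu
    change _ ∈ L
    rw [hr]
    exact hLs hu
end

section
/- (Idempotence.) Let R be a Noetherian ring and L ⊆ M R-modules. Then lic(lic(L,M), M) = lic(L,M). -/
theorem LIC.le_freeIC {R : Type*} [CommRing R] {ι : Type*} (U : Submodule R (ι →₀ R)) :
    U ≤ LIC.freeIC U := by
  intro x hx
  exact isIntegral_algebraMap (R := Algebra.adjoin R (LIC.symEmb R ι '' U))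
    (x := ⟨LIC.symEmb R ι x, Algebra.subset_adjoin ⟨x, hx, rfl⟩⟩)

theorem LIC.isIntegral_of_le {R S : Type*} [CommRing R] [CommRing S] [Algebra R S]
    {A B : Subalgebra R S} (h : ∀ y ∈ B, IsIntegral A y) {x : S} (hx : IsIntegral B x) :
    IsIntegral A x := by
  have h2 : IsIntegral (integralClosure A S) x :=
    hx.map_of_comp_eq
      (B.val.toRingHom.codRestrict (integralClosure A S) (fun y => h y y.2)) (RingHom.id S) rfl
  exact isIntegral_trans (R := A) (A := integralClosure A S) _ h2

theorem LIC.freeIC_idem {R : Type*} [CommRing R] {ι : Type*} (U : Submodule R (ι →₀ R)) :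
    LIC.freeIC (LIC.freeIC U) = LIC.freeIC U := by
  refine le_antisymm ?_ (LIC.le_freeIC _)
  intro x hx
  refine LIC.isIntegral_of_le (B := Algebra.adjoin R (LIC.symEmb R ι '' (LIC.freeIC U))) ?_ hx
  intro y hy
  have h : Algebra.adjoin R (LIC.symEmb R ι '' (LIC.freeIC U)) ≤
      (integralClosure (Algebra.adjoin R (LIC.symEmb R ι '' U))
        (MvPolynomial ι R)).restrictScalars R := by
    refine Algebra.adjoin_le ?_
    rintro _ ⟨y, hy, rfl⟩
    exact hy
  exact h hy

/-- **Idempotence.** Over a Noetherian ring,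
`lic(lic(L,M), M) = lic(L,M)`. -/
theorem lic_idem {R : Type*} [CommRing R] [IsNoetherianRing R]
    {M : Type*} [AddCommGroup M] [Module R M] (L : Submodule R M) :
    LIC.lic (LIC.lic L) = LIC.lic L := by
  have h : Submodule.comap (Finsupp.linearCombination R (id : M → M)) (LIC.lic L) =
      LIC.freeIC (Submodule.comap (Finsupp.linearCombination R (id : M → M)) L) := by
    unfold LIC.lic
    rw [Submodule.comap_map_eq, sup_eq_left]
    refine le_trans ?_ (LIC.le_freeIC _)
    intro x hx
    rw [LinearMap.mem_ker] at hx
    rw [Submodule.mem_comap, hx]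
    exact L.zero_mem
  rw [LIC.lic, h, LIC.freeIC_idem, LIC.lic]
end

section
/- (Functoriality.) Let R be a Noetherian ring, L ⊆ M R-modules, and h : M → N a homomorphism of R-modules. Then h(lic(L,M)) ⊆ lic(h(L), N). -/
/-- **Functoriality.** Over a Noetherian ring, for any `R`-linear map
`h : M → N` and submodule `L ⊆ M`, `h(lic(L,M)) ⊆ lic(h(L), N)`. -/
theorem lic_map_le {R : Type*} [CommRing R] [IsNoetherianRing R]
    {M N : Type*} [AddCommGroup M] [Module R M] [AddCommGroup N] [Module R N]
    (L : Submodule R M) (h : M →ₗ[R] N) :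
    Submodule.map h (LIC.lic L) ≤ LIC.lic (Submodule.map h L) := by
  classical
  rintro _ ⟨_, ⟨x, hx, rfl⟩, rfl⟩
  have hemb : ∀ y : M →₀ R, MvPolynomial.rename h (LIC.symEmb R M y)
      = LIC.symEmb R N (Finsupp.lmapDomain R R h y) := by
    intro y
    have : (MvPolynomial.rename (R := R) h).toLinearMap ∘ₗ LIC.symEmb R M
        = LIC.symEmb R N ∘ₗ Finsupp.lmapDomain R R h := by
      ext i : 2
      simp [LIC.symEmb]
    exact congrArg (fun f => f y) this
  have hpi : ∀ y : M →₀ R, Finsupp.linearCombination R (id : N → N) (Finsupp.lmapDomain R R h y)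
      = h (Finsupp.linearCombination R (id : M → M) y) := by
    intro y
    have : Finsupp.linearCombination R (id : N → N) ∘ₗ Finsupp.lmapDomain R R h
        = h ∘ₗ Finsupp.linearCombination R (id : M → M) := by
      ext i
      simp
    exact congrArg (fun f => f y) this
  refine ⟨Finsupp.lmapDomain R R h x, ?_, hpi x⟩
  change IsIntegral _ (LIC.symEmb R N _)
  rw [← hemb]
  replace hx : IsIntegral _ (LIC.symEmb R M x) := hx
  have hle : ∀ a : Algebra.adjoin R (LIC.symEmb R M ''
      (Submodule.comap (Finsupp.linearCombination R (id : M → M)) L : Set (M →₀ R))),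
      MvPolynomial.rename h (a : MvPolynomial M R) ∈ Algebra.adjoin R (LIC.symEmb R N ''
      (Submodule.comap (Finsupp.linearCombination R (id : N → N)) (Submodule.map h L) :
        Set (N →₀ R))) := by
    rintro ⟨a, ha⟩
    have h1 := (Subalgebra.mem_map (f := MvPolynomial.rename (R := R) h)).2 ⟨a, ha, rfl⟩
    rw [AlgHom.map_adjoin] at h1
    refine Algebra.adjoin_mono ?_ h1
    rintro _ ⟨_, ⟨y, hy, rfl⟩, rfl⟩
    refine ⟨Finsupp.lmapDomain R R h y, ?_, (hemb y).symm⟩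
    exact ⟨_, hy, (hpi y).symm⟩
  refine IsIntegral.map_of_comp_eq
    (((MvPolynomial.rename (R := R) h).comp (Subalgebra.val _)).codRestrict _ hle).toRingHom
    (MvPolynomial.rename (R := R) h).toRingHom ?_ hx
  ext a
  rfl
end

section
/- (Submodules.) Let R be a Noetherian ring and K ⊆ L ⊆ M R-modules. Then lic(K,L) ⊆ lic(K,M) ⊆ lic(L,M), where lic(K,L) is viewed as a submodule of M via the inclusion L ⊆ M. -/
theorem LIC.freeIC_mapDomain {R : Type*} [CommRing R] {ι κ : Type*} (f : ι → κ)
    (U : Submodule R (ι →₀ R)) (V : Submodule R (κ →₀ R))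
    (h : ∀ u ∈ U, Finsupp.mapDomain f u ∈ V) (x : ι →₀ R) (hx : x ∈ LIC.freeIC U) :
    Finsupp.mapDomain f x ∈ LIC.freeIC V := by
  have key : ∀ y : ι →₀ R, MvPolynomial.rename f (LIC.symEmb R ι y)
      = LIC.symEmb R κ (Finsupp.mapDomain f y) := by
    intro y
    simp only [LIC.symEmb, Finsupp.linearCombination_mapDomain]
    simp [Finsupp.linearCombination_apply, Finsupp.sum, map_sum]
  have hle : ∀ a ∈ Algebra.adjoin R (LIC.symEmb R ι '' U),
      MvPolynomial.rename f a ∈ Algebra.adjoin R (LIC.symEmb R κ '' V) := by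
    have : Algebra.adjoin R (LIC.symEmb R ι '' U) ≤
        (Algebra.adjoin R (LIC.symEmb R κ '' V)).comap (MvPolynomial.rename f) := by
      rw [Algebra.adjoin_le_iff]
      rintro _ ⟨u, hu, rfl⟩
      refine Algebra.subset_adjoin ⟨Finsupp.mapDomain f u, h u hu, (key u).symm⟩
    exact this
  change IsIntegral _ _
  rw [← key]
  let φ : Algebra.adjoin R (LIC.symEmb R ι '' U) →ₐ[R]
      Algebra.adjoin R (LIC.symEmb R κ '' V) :=
    ((MvPolynomial.rename f).comp (Subalgebra.val _)).codRestrict _ (fun a => hle a a.2)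
  exact IsIntegral.map_of_comp_eq φ.toRingHom
    (MvPolynomial.rename (R := R) f).toRingHom rfl hx

theorem LIC.lic_map {R : Type*} [CommRing R] {M N : Type*} [AddCommGroup M] [Module R M]
    [AddCommGroup N] [Module R N] (g : M →ₗ[R] N) (K : Submodule R M) (K' : Submodule R N)
    (h : ∀ k ∈ K, g k ∈ K') (x : M) (hx : x ∈ LIC.lic K) : g x ∈ LIC.lic K' := by
  have key : ∀ y : M →₀ R, Finsupp.linearCombination R (id : N → N) (Finsupp.mapDomain g y)
      = g (Finsupp.linearCombination R (id : M → M) y) := by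
    intro y
    rw [Finsupp.linearCombination_mapDomain]
    simp [Finsupp.linearCombination_apply, Finsupp.sum, map_sum]
  obtain ⟨y, hy, rfl⟩ := hx
  refine ⟨Finsupp.mapDomain g y, LIC.freeIC_mapDomain g _ _ ?_ y hy, key y⟩
  intro u hu
  rw [Submodule.mem_comap, key]
  exact h _ hu

/-- **Submodules.** Over a Noetherian ring, if `K ⊆ L ⊆ M`, then
`lic(K,L) ⊆ lic(K,M) ⊆ lic(L,M)` (where `lic(K,L)` is viewed inside `M` via `L ⊆ M`). -/
theorem lic_mono {R : Type*} [CommRing R] [IsNoetherianRing R]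
    {M : Type*} [AddCommGroup M] [Module R M] (K L : Submodule R M) (hKL : K ≤ L) :
    Submodule.map L.subtype (LIC.lic (Submodule.comap L.subtype K)) ≤ LIC.lic K ∧
      LIC.lic K ≤ LIC.lic L := by
  constructor
  · rintro _ ⟨x, hx, rfl⟩
    exact LIC.lic_map L.subtype _ K (fun k hk => hk) x hx
  · intro x hx
    exact LIC.lic_map LinearMap.id K L (fun k hk => hKL hk) x hx
end

section
/- (Comparison to Rees integral closure.) Let R be a Noetherian ring and L ⊆ M R-modules. Then lic(L,M) is contained in the Rees integral closure of L in M, and equality holds if M is a free R-module. -/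
namespace LIC

open scoped TensorProduct

/-- The Rees integral closure of `L ⊆ M` over a domain `R`: those `x ∈ M` such that for
every valuation ring `V` between `R` and its fraction field `Q`, the image of `x` in
`M ⊗_R Q` lies in the image `LV` of `L ⊗_R V → M ⊗_R Q` (i.e. in the set of finite sums
of elements `v • (1 ⊗ l)` with `v ∈ V`, `l ∈ L`). -/
def reesClosureDomain {R : Type*} [CommRing R] [IsDomain R]
    {M : Type*} [AddCommGroup M] [Module R M] (L : Submodule R M) : Set M :=
  {x | ∀ V : ValuationSubring (FractionRing R),
      Set.range (algebraMap R (FractionRing R)) ⊆ (V : Set (FractionRing R)) →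
      (1 : FractionRing R) ⊗ₜ[R] x ∈
        AddSubmonoid.closure
          {y : FractionRing R ⊗[R] M |
            ∃ v ∈ V, ∃ l ∈ L, y = v • ((1 : FractionRing R) ⊗ₜ[R] l)}}

/-- The Rees integral closure of `L ⊆ M` over a general commutative ring `R`:
`x ∈ Ric(L,M)` iff for every minimal prime `p` of `R`, the image of `x` in `M/pM` lies in
the Rees integral closure (over the domain `R/p`) of `(L + pM)/pM` in `M/pM`. -/
def reesClosure {R : Type*} [CommRing R] {M : Type*} [AddCommGroup M] [Module R M]
    (L : Submodule R M) : Set M :=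
  {x | ∀ p ∈ minimalPrimes R, ∀ _hp : p.IsPrime,
      (Submodule.Quotient.mk x : M ⧸ (p • ⊤ : Submodule R M)) ∈
        reesClosureDomain
          (Submodule.span (R ⧸ p)
            ((Submodule.mkQ (p • ⊤ : Submodule R M)) '' L))}

universe w

/-- The EHU integral closure of `L ⊆ M`: those `x ∈ M` such that for every `R`-linear map
`g : M → F` to a free module `F`, `g x` lies in the integral closure of `g(L)` in `F`. -/
def ehuClosure {R : Type*} [CommRing R] {M : Type*} [AddCommGroup M] [Module R M]
    (L : Submodule R M) : Set M :=
  {x | ∀ (ι : Type w) (g : M →ₗ[R] (ι →₀ R)), g x ∈ freeIC (Submodule.map g L)}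

end LIC

section Helpers

open scoped TensorProduct

open Polynomial in
theorem isIntegralElem_of_range {A E : Type*} [CommRing A] [CommRing E] (f : A →+* E) (x : E)
    (h : IsIntegral f.range x) : f.IsIntegralElem x := by
  obtain ⟨q, hq, hx⟩ := h
  have hl : q ∈ Polynomial.lifts f.rangeRestrict := by
    rw [Polynomial.lifts_iff_coeff_lifts]
    intro n
    exact f.rangeRestrict_surjective _
  obtain ⟨q', h1, -, h3⟩ := Polynomial.lifts_and_natDegree_eq_and_monic hl hq
  refine ⟨q', h3, ?_⟩
  rw [← h1, Polynomial.eval₂_map] at hx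
  exact hx

theorem finite_adjoin {R S : Type*} [CommRing R] [CommRing S] [Algebra R S] (s : Set S) (x : S)
    (h : IsIntegral (Algebra.adjoin R s) x) :
    ∃ t ⊆ s, t.Finite ∧ IsIntegral (Algebra.adjoin R t) x := by
  have key : ∀ a ∈ Algebra.adjoin R s, ∃ t ⊆ s, t.Finite ∧ a ∈ Algebra.adjoin R t := by
    intro a ha
    induction ha using Algebra.adjoin_induction with
    | mem a ha => exact ⟨{a}, by simpa using ha, by simp, Algebra.subset_adjoin (by simp)⟩
    | algebraMap r => exact ⟨∅, by simp, by simp, Subalgebra.algebraMap_mem _ r⟩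
    | add a b _ _ iha ihb =>
      obtain ⟨t, h1, h2, h3⟩ := iha
      obtain ⟨t', h1', h2', h3'⟩ := ihb
      exact ⟨t ∪ t', by simp [*], h2.union h2',
        add_mem (Algebra.adjoin_mono (by simp) h3) (Algebra.adjoin_mono (by simp) h3')⟩
    | mul a b _ _ iha ihb =>
      obtain ⟨t, h1, h2, h3⟩ := iha
      obtain ⟨t', h1', h2', h3'⟩ := ihb
      exact ⟨t ∪ t', by simp [*], h2.union h2',
        mul_mem (Algebra.adjoin_mono (by simp) h3) (Algebra.adjoin_mono (by simp) h3')⟩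
  obtain ⟨q, hq, hx⟩ := h
  choose t ht hf hm using fun n => key (q.coeff n) (q.coeff n).2
  let T : Set S := ⋃ n ∈ q.support, t n
  have hT : T ⊆ s := by simp [T, ht]
  refine ⟨T, hT, ?_, ?_⟩
  · exact Set.Finite.biUnion q.support.finite_toSet fun n _ => hf n
  have hl : q ∈ Polynomial.lifts (Subalgebra.inclusion (Algebra.adjoin_mono (R := R) hT)).toRingHom := by
    rw [Polynomial.lifts_iff_coeff_lifts]
    intro n
    by_cases hn : n ∈ q.support
    · exact ⟨⟨q.coeff n, Algebra.adjoin_mono (Set.subset_biUnion_of_mem (u := t) hn) (hm n)⟩, rfl⟩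
    · exact ⟨0, by rw [Polynomial.notMem_support_iff.mp hn, map_zero]⟩
  obtain ⟨q', h1, -, h3⟩ := Polynomial.lifts_and_natDegree_eq_and_monic hl hq
  refine ⟨q', h3, ?_⟩
  rw [← h1, Polynomial.eval₂_map] at hx
  exact hx

open Polynomial in
theorem sep_functional {Q W : Type*} [Field Q] (V : ValuationSubring Q) [AddCommGroup W]
    [Module Q W] (s : Set W) (hs : s.Finite) (x : W) (hx : x ∉ Submodule.span V s) :
    ∃ φ : W →ₗ[Q] Q[X], (∀ u ∈ s, φ u ∈ (C.comp V.subtype : V →+* Q[X]).range) ∧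
      ¬ IsIntegral (C.comp V.subtype : V →+* Q[X]).range (φ x) := by
  by_cases hxs : x ∈ Submodule.span Q s
  · have : Module.Finite V (Submodule.span V s) := .span_of_finite V hs
    have : Module.Flat V (Submodule.span V s) := by
      rw [Module.Flat.flat_iff_torsion_eq_bot_of_isBezout,
        ← Submodule.isTorsionFree_iff_torsion_eq_bot]
      have : Module.IsTorsionFree V W := .trans_faithfulSMul V Q W
      infer_instance
    have : Module.Free V (Submodule.span V s) := Module.free_of_flat_of_isLocalRing
    let b := Module.Free.chooseBasis V (Submodule.span V s)
    have hb : LinearIndependent V (fun i => (b i : W)) :=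
      b.linearIndependent.map' (Submodule.span V s).subtype (Submodule.ker_subtype _)
    rw [LinearIndependent.iff_fractionRing V Q] at hb
    have hsp : ∀ u ∈ Submodule.span V s, ∃ d : _ → V,
        u = ∑ i, (d i : Q) • (b i : W) := by
      intro u hu
      refine ⟨fun i => b.repr ⟨u, hu⟩ i, ?_⟩
      have := congrArg Subtype.val (b.sum_repr ⟨u, hu⟩)
      rw [AddSubmonoidClass.coe_finsetSum] at this
      exact this.symm
    have hx2 : x ∈ Submodule.span Q (Set.range fun i => (b i : W)) := by
      refine (Submodule.span_le.mpr ?_ : Submodule.span Q s ≤ _) hxs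
      intro u hu
      obtain ⟨d, hd⟩ := hsp u (Submodule.subset_span hu)
      rw [hd]
      exact Submodule.sum_mem _ fun i _ => Submodule.smul_mem _ _ (Submodule.subset_span ⟨i, rfl⟩)
    obtain ⟨c, hc⟩ := (Submodule.mem_span_range_iff_exists_fun Q).mp hx2
    have : ∃ i, c i ∉ V := by
      by_contra! hcon
      apply hx
      rw [← hc]
      exact Submodule.sum_mem _ fun i _ => Submodule.smul_mem _ (⟨c i, hcon i⟩ : V) (b i).2
    obtain ⟨i, hi⟩ := this
    classical
    let B := Module.Basis.span hb
    obtain ⟨g, hg⟩ := LinearMap.exists_extend (B.coord i)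
    have hgb : ∀ j, g (b j) = if j = i then 1 else 0 := by
      intro j
      have h1 : (B j : W) = b j :=
        congrArg Subtype.val (Module.Basis.span_apply hb j)
      have h2 := LinearMap.congr_fun hg (B j)
      simp only [LinearMap.comp_apply, Submodule.subtype_apply, h1] at h2
      rw [h2]
      simp [Finsupp.single_apply]
    have hgs : ∀ d : _ → Q, g (∑ j, d j • (b j : W)) = d i := by
      intro d
      simp [hgb]
    refine ⟨(Polynomial.monomial 0).comp g, ?_, ?_⟩
    · intro u hu
      obtain ⟨d, hd⟩ := hsp u (Submodule.subset_span hu)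
      rw [hd]
      simp only [LinearMap.comp_apply, hgs]
      exact ⟨d i, rfl⟩
    · rw [LinearMap.comp_apply, ← hc, hgs]
      intro hint
      have h1 := isIntegralElem_of_range _ _ hint
      obtain ⟨q, hq, h0⟩ := h1
      have : IsIntegral V (c i) := by
        refine ⟨q, hq, ?_⟩
        rw [Polynomial.monomial_zero_left, ← Polynomial.hom_eval₂] at h0
        exact Polynomial.C_injective (h0.trans (map_zero _).symm)
      obtain ⟨y, hy⟩ := IsIntegrallyClosed.isIntegral_iff.mp this
      exact hi (hy ▸ y.2)
  · obtain ⟨g, hg1, hg2⟩ := Submodule.exists_le_ker_of_notMem hxs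
    refine ⟨(Polynomial.monomial 1).comp g, ?_, ?_⟩
    · intro u hu
      have : g u = 0 := hg2 (Submodule.subset_span hu)
      simp only [LinearMap.comp_apply, this, map_zero]
      exact zero_mem _
    · intro hint
      obtain ⟨q, hq, h0⟩ := isIntegralElem_of_range _ _ hint
      have : IsIntegral Q (Polynomial.monomial 1 (g x)) := by
        refine ⟨q.map V.subtype, hq.map _, ?_⟩
        rw [Polynomial.eval₂_map]
        exact h0
      have h2 := (IsIntegral.algebraMap (A := Q) (R := Q) (B := Q[X]) (isIntegral_algebraMap (x := (g x)⁻¹))).mul this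
      have h3 : algebraMap Q Q[X] (algebraMap Q Q (g x)⁻¹) * Polynomial.monomial 1 (g x) = X := by
        simp [Polynomial.algebraMap_eq, Polynomial.C_mul_monomial, hg1, Polynomial.X]
      rw [h3] at h2
      exact Polynomial.transcendental_X Q h2.isAlgebraic

theorem part1 {R Q M W : Type*} [CommRing R] [Field Q] [AddCommGroup M] [Module R M]
    [AddCommGroup W] [Module Q W] (σ : R →+* Q) (V : ValuationSubring Q) (hV : ∀ r, σ r ∈ V)
    (j : M →+ W) (hj : ∀ (r : R) (m : M), j (r • m) = σ r • j m) (L : Submodule R M) (x : M)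
    (hx : x ∈ LIC.lic L) : j x ∈ AddSubmonoid.closure {y | ∃ v ∈ V, ∃ l ∈ L, y = v • j l} := by
  suffices h : j x ∈ Submodule.span V (j '' L) by
    rw [← Submodule.mem_toAddSubmonoid, Submodule.span_eq_closure] at h
    refine AddSubmonoid.closure_mono ?_ h
    rintro _ ⟨v, -, _, ⟨l, hl, rfl⟩, rfl⟩
    exact ⟨v, v.2, l, hl, rfl⟩
  obtain ⟨k, hk, rfl⟩ := hx
  obtain ⟨t, ht, htf, hint⟩ := finite_adjoin _ _ (show IsIntegral _ _ from hk)
  obtain ⟨s, hs, hbij⟩ := Set.SurjOn.exists_bijOn_subset ht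
  have hsf : s.Finite := hbij.finite_iff_finite.mpr htf
  obtain rfl := hbij.image_eq
  let π := Finsupp.linearCombination R (id : M → M)
  by_contra hcon
  have hsub : Submodule.span V ((fun a => j (π a)) '' s) ≤ Submodule.span V (j '' L) := by
    apply Submodule.span_mono
    rintro _ ⟨a, ha, rfl⟩
    exact ⟨π a, hs ha, rfl⟩
  obtain ⟨φ, h1, h2⟩ := sep_functional V ((fun a => j (π a)) '' s) (hsf.image _) (j (π k))
    (fun h => hcon (hsub h))
  apply h2
  let Θ : MvPolynomial M R →+* Polynomial Q :=
    MvPolynomial.eval₂Hom (Polynomial.C.comp σ) (fun m => φ (j m))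
  have hΘ : ∀ a : M →₀ R, Θ (LIC.symEmb R M a) = φ (j (π a)) := by
    intro a
    induction a using Finsupp.induction_linear with
    | zero => simp
    | add f g hf hg => simp only [map_add, hf, hg]
    | single m r =>
      simp [Θ, π, LIC.symEmb, hj, MvPolynomial.smul_eq_C_mul, Polynomial.smul_eq_C_mul]
  rw [← hΘ]
  have hA : ∀ a ∈ Algebra.adjoin R (LIC.symEmb R M '' s),
      Θ a ∈ (Polynomial.C.comp V.subtype : V →+* Polynomial Q).range := by
    intro a ha
    induction ha using Algebra.adjoin_induction with
    | mem a ha =>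
      obtain ⟨y, hy, rfl⟩ := ha
      rw [hΘ]
      exact h1 _ ⟨y, hy, rfl⟩
    | algebraMap r =>
      refine ⟨⟨σ r, hV r⟩, ?_⟩
      simp [Θ, MvPolynomial.algebraMap_eq]
    | add a b _ _ ha hb => rw [map_add]; exact add_mem ha hb
    | mul a b _ _ ha hb => rw [map_mul]; exact mul_mem ha hb
  let g : Algebra.adjoin R (LIC.symEmb R M '' s) →+*
      (Polynomial.C.comp V.subtype : V →+* Polynomial Q).range :=
    (Θ.comp (Algebra.adjoin R (LIC.symEmb R M '' s)).val.toRingHom).codRestrict _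
      (fun a => hA a a.2)
  exact hint.map_of_comp_eq g Θ rfl

theorem lic_sub {R M : Type*} [CommRing R] [AddCommGroup M] [Module R M] (L : Submodule R M) :
    (LIC.lic L : Set M) ⊆ LIC.reesClosure L := by
  intro x hx p hp _ V hV
  let j : M →+ TensorProduct (R ⧸ p) (FractionRing (R ⧸ p)) (M ⧸ (p • ⊤ : Submodule R M)) :=
    ((TensorProduct.mk (R ⧸ p) (FractionRing (R ⧸ p)) (M ⧸ (p • ⊤ : Submodule R M))) 1
      ).toAddMonoidHom.comp (Submodule.mkQ (p • ⊤ : Submodule R M)).toAddMonoidHom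
  have h := part1 ((algebraMap (R ⧸ p) (FractionRing (R ⧸ p))).comp (Ideal.Quotient.mk p)) V
    (fun r => hV ⟨_, rfl⟩) j (by
      intro r m
      change (1 : FractionRing (R ⧸ p)) ⊗ₜ[R ⧸ p] (Submodule.Quotient.mk (r • m)) =
        _ • (1 : FractionRing (R ⧸ p)) ⊗ₜ[R ⧸ p] (Submodule.Quotient.mk m)
      have : (Submodule.Quotient.mk (r • m) : M ⧸ (p • ⊤ : Submodule R M)) =
        (Ideal.Quotient.mk p r) • Submodule.Quotient.mk m := rfl
      rw [this, RingHom.comp_apply, algebraMap_smul, TensorProduct.tmul_smul]) L x hx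
  refine AddSubmonoid.closure_mono ?_ h
  rintro _ ⟨v, hv, l, hl, rfl⟩
  exact ⟨v, hv, Submodule.Quotient.mk l, Submodule.subset_span ⟨l, hl, rfl⟩, rfl⟩

theorem freeIC_le_lic {R ι : Type*} [CommRing R] (L : Submodule R (ι →₀ R)) :
    LIC.freeIC L ≤ LIC.lic L := by
  intro x hx
  let s : (ι →₀ R) →ₗ[R] ((ι →₀ R) →₀ R) :=
    Finsupp.lmapDomain R R (fun i => Finsupp.single i (1 : R))
  have hs : ∀ y, Finsupp.linearCombination R (id : (ι →₀ R) → _) (s y) = y := by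
    intro y
    simp [s, Finsupp.linearCombination_mapDomain]
    induction y using Finsupp.induction_linear with
    | zero => simp
    | add f g hf hg => simp only [map_add, hf, hg]
    | single m r => simp
  let Θ : MvPolynomial ι R →ₐ[R] MvPolynomial (ι →₀ R) R :=
    MvPolynomial.rename (fun i => Finsupp.single i (1 : R))
  have hΘ : ∀ y, Θ (LIC.symEmb R ι y) = LIC.symEmb R (ι →₀ R) (s y) := by
    intro y
    induction y using Finsupp.induction_linear with
    | zero => simp
    | add f g hf hg => simp only [map_add, hf, hg]
    | single m r => simp [Θ, s, LIC.symEmb]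
  refine ⟨s x, ?_, hs x⟩
  change IsIntegral _ _
  rw [← hΘ]
  set K := Submodule.comap (Finsupp.linearCombination R (id : (ι →₀ R) → _)) L
  have hA : ∀ a ∈ Algebra.adjoin R (LIC.symEmb R ι '' L),
      Θ a ∈ Algebra.adjoin R (LIC.symEmb R (ι →₀ R) '' K) := by
    intro a ha
    have : Algebra.adjoin R (LIC.symEmb R ι '' L) ≤
        (Algebra.adjoin R (LIC.symEmb R (ι →₀ R) '' K)).comap Θ := by
      refine Algebra.adjoin_le ?_
      rintro _ ⟨y, hy, rfl⟩
      refine Algebra.subset_adjoin ⟨s y, ?_, (hΘ y).symm⟩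
      change Finsupp.linearCombination R (id : (ι →₀ R) → _) (s y) ∈ L
      rwa [hs]
    exact this ha
  let g : Algebra.adjoin R (LIC.symEmb R ι '' L) →+*
      Algebra.adjoin R (LIC.symEmb R (ι →₀ R) '' K) :=
    (Θ.toRingHom.comp (Algebra.adjoin R (LIC.symEmb R ι '' L)).val.toRingHom).codRestrict
      (Algebra.adjoin R (LIC.symEmb R (ι →₀ R) '' K)) (fun a => hA a a.2)
  exact IsIntegral.map_of_comp_eq g Θ.toRingHom rfl (show IsIntegral _ _ from hx)

/-- If `x` is integral modulo the extension of every minimal prime, it is integral. -/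
theorem exists_min_prime {R S A : Type*} [CommRing R] [CommRing S] [CommRing A] (i : R →+* S)
    (f : A →+* S) (x : S) (h : ¬ f.IsIntegralElem x) :
    ∃ p ∈ minimalPrimes R, ∀ q : Polynomial A, q.Monic → q.eval₂ f x ∉ p.map i := by
  let T : Submonoid S :=
    { carrier := {y | ∃ q : Polynomial A, q.Monic ∧ q.eval₂ f x = y}
      one_mem' := ⟨1, Polynomial.monic_one, by simp⟩
      mul_mem' := by
        rintro _ _ ⟨q, hq, rfl⟩ ⟨q', hq', rfl⟩
        exact ⟨q * q', hq.mul hq', Polynomial.eval₂_mul _ _⟩ }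
  have hd : Disjoint ((⊥ : Ideal S) : Set S) T := by
    rw [Set.disjoint_left]
    rintro y hy ⟨q, hq, rfl⟩
    exact h ⟨q, hq, by simpa using hy⟩
  obtain ⟨P, hP, -, hPT⟩ := Ideal.exists_le_prime_disjoint _ T hd
  obtain ⟨p, hp, hpP⟩ := Ideal.exists_minimalPrimes_le (I := ⊥) (J := P.comap i) bot_le
  refine ⟨p, hp, fun q hq hmem => ?_⟩
  exact Set.disjoint_left.mp hPT (Ideal.map_le_iff_le_comap.mpr hpP hmem) ⟨q, hq, rfl⟩

theorem rees_sub {R ι : Type*} [CommRing R] (L : Submodule R (ι →₀ R)) (x : ι →₀ R)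
    (hx : x ∈ LIC.reesClosure L) : x ∈ LIC.freeIC L := by
  by_contra hcon
  let A := Algebra.adjoin R (LIC.symEmb R ι '' L)
  obtain ⟨p, hp, hq⟩ := exists_min_prime (MvPolynomial.C : R →+* MvPolynomial ι R)
    (algebraMap A (MvPolynomial ι R)) (LIC.symEmb R ι x) hcon
  have hpp : p.IsPrime := hp.1.1
  let Q := FractionRing (R ⧸ p)
  let E := FractionRing (MvPolynomial ι Q)
  let σ : R →+* Q := (algebraMap (R ⧸ p) Q).comp (Ideal.Quotient.mk p)
  have hσ : RingHom.ker σ = p := by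
    rw [RingHom.ker_comp_of_injective _ (IsFractionRing.injective (R ⧸ p) Q), Ideal.mk_ker]
  let θ : MvPolynomial ι R →+* E := (algebraMap (MvPolynomial ι Q) E).comp (MvPolynomial.map σ)
  have hθ : RingHom.ker θ = p.map MvPolynomial.C := by
    rw [RingHom.ker_comp_of_injective _ (IsFractionRing.injective (MvPolynomial ι Q) E),
      MvPolynomial.ker_map, hσ]
  let f : A →+* E := θ.comp (algebraMap A (MvPolynomial ι R))
  have hni : ¬ IsIntegral f.range (θ (LIC.symEmb R ι x)) := by
    intro hint
    obtain ⟨q, hq1, hq2⟩ := isIntegralElem_of_range _ _ hint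
    refine hq q hq1 ?_
    rw [← hθ, RingHom.mem_ker, Polynomial.hom_eval₂]
    exact hq2
  obtain ⟨V', hV', hxV⟩ : ∃ V' : ValuationSubring E, f.range ≤ V'.toSubring ∧
      θ (LIC.symEmb R ι x) ∉ V' := by
    by_contra! hall
    apply hni
    have h1 := iInf_valuationSubring_superset (K := E) (s := (f.range : Set E))
    have h2 : θ (LIC.symEmb R ι x) ∈ 
        (integralClosure (Subring.closure (f.range : Set E)) E).toSubring := by
      rw [← h1, Subring.mem_iInf]
      rintro ⟨V, hV⟩
      exact hall V hV
    have h3 : IsIntegral (Subring.closure (f.range : Set E)) (θ (LIC.symEmb R ι x)) := h2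
    rwa [Subring.closure_eq] at h3
  let V : ValuationSubring Q := V'.comap (algebraMap Q E)
  have hsm : ∀ (r : R) (e : E), r • e = θ (MvPolynomial.C r) * e := by
    intro r e
    rw [Algebra.smul_def, IsScalarTower.algebraMap_apply R Q E]
    simp only [θ, RingHom.comp_apply, MvPolynomial.map_C]
    rfl
  let Λ0 : (ι →₀ R) →ₗ[R] E := Finsupp.linearCombination R (fun i => θ (MvPolynomial.X i))
  have hΛ0 : ∀ y, Λ0 y = θ (LIC.symEmb R ι y) := by
    intro y
    induction y using Finsupp.induction_linear with
    | zero => simp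
    | add f g hf hg => simp only [map_add, hf, hg]
    | single m r => simp [Λ0, LIC.symEmb, MvPolynomial.smul_eq_C_mul, hsm]
  have hker : (p • ⊤ : Submodule R (ι →₀ R)) ≤ LinearMap.ker Λ0 := by
    rw [Submodule.smul_le]
    intro r hr y _
    have : θ (MvPolynomial.C r) = 0 := by
      rw [← RingHom.mem_ker, hθ]
      exact Ideal.mem_map_of_mem _ hr
    rw [LinearMap.mem_ker, map_smul, hsm, this, zero_mul]
  let Λ1 : ((ι →₀ R) ⧸ (p • ⊤ : Submodule R (ι →₀ R))) →ₗ[R ⧸ p] E :=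
    LinearMap.extendScalarsOfSurjective Ideal.Quotient.mk_surjective
      (Submodule.liftQ (p • ⊤ : Submodule R (ι →₀ R)) Λ0 hker)
  let Λ := LinearMap.liftBaseChange Q Λ1
  have hΛ : ∀ y : ι →₀ R, Λ ((1 : Q) ⊗ₜ[R ⧸ p] Submodule.Quotient.mk y) = 
      θ (LIC.symEmb R ι y) := by
    intro y
    rw [← hΛ0]
    simp [Λ, Λ1]
  have hRV : ∀ r : R, θ (MvPolynomial.C r) ∈ V' := fun r =>
    hV' ⟨algebraMap R A r, rfl⟩
  have hLV : ∀ y ∈ Submodule.span (R ⧸ p) ((Submodule.mkQ (p • ⊤ : Submodule R (ι →₀ R))) '' L),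
      Λ ((1 : Q) ⊗ₜ[R ⧸ p] y) ∈ V' := by
    intro y hy
    induction hy using Submodule.span_induction with
    | mem y hy =>
      obtain ⟨l, hl, rfl⟩ := hy
      rw [Submodule.mkQ_apply, hΛ]
      exact hV' ⟨⟨_, Algebra.subset_adjoin ⟨l, hl, rfl⟩⟩, rfl⟩
    | zero => rw [TensorProduct.tmul_zero, map_zero]; exact zero_mem _
    | add a b _ _ ha hb => rw [TensorProduct.tmul_add, map_add]; exact add_mem ha hb
    | smul r a _ ha =>
      obtain ⟨r, rfl⟩ := Ideal.Quotient.mk_surjective r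
      have : Λ ((1 : Q) ⊗ₜ[R ⧸ p] ((Ideal.Quotient.mk p r) • a)) =
          θ (MvPolynomial.C r) * Λ ((1 : Q) ⊗ₜ[R ⧸ p] a) := by
        rw [← hsm]
        simp only [Λ, LinearMap.liftBaseChange_tmul, map_smul, one_smul]
        exact algebraMap_smul (R ⧸ p) r (Λ1 a)
      rw [this]
      exact mul_mem (hRV r) ha
  have hrees := hx p hp hpp V (by
    rintro _ ⟨r, rfl⟩
    obtain ⟨r, rfl⟩ := Ideal.Quotient.mk_surjective r
    have := hRV r
    simp only [θ, RingHom.comp_apply, MvPolynomial.map_C] at this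
    exact this)
  apply hxV
  rw [← hΛ]
  refine AddSubmonoid.closure_induction (motive := fun y _ => Λ y ∈ V') ?_ ?_ ?_ hrees
  · rintro _ ⟨v, hv, l, hl, rfl⟩
    rw [map_smul, Algebra.smul_def]
    exact mul_mem hv (hLV l hl)
  · rw [map_zero]
    exact zero_mem _
  · intro a b _ _ ha hb
    rw [map_add]
    exact add_mem ha hb

end Helpers

universe u

/-- **Comparison to Rees integral closure.** Over a Noetherian ring `R`,
`lic(L,M)` is contained in the Rees integral closure of `L` in `M`, with equality when
`M` is free. -/
theorem lic_le_reesClosure (R : Type u) [CommRing R] [IsNoetherianRing R] :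
    (∀ (M : Type u) (_ : AddCommGroup M) (_ : Module R M) (L : Submodule R M),
        (LIC.lic L : Set M) ⊆ LIC.reesClosure L) ∧
    (∀ (ι : Type u) (L : Submodule R (ι →₀ R)),
        (LIC.lic L : Set (ι →₀ R)) = LIC.reesClosure L) := by
  exact ⟨fun M _ _ L => lic_sub L, fun ι L => Set.Subset.antisymm (lic_sub L)
    fun x hx => freeIC_le_lic L (rees_sub L x hx)⟩
end

section
/- (Colons.) Let R be a Noetherian ring and L ⊆ M R-modules with L = lic(L,M). Then for every ideal J of R, the submodule (L :_M J) = {x ∈ M : Jx ⊆ L} satisfies lic((L :_M J), M) = (L :_M J), and for every submodule U ⊆ M, the ideal (L :_R U) = {r ∈ R : rU ⊆ L} is integrally closed as an ideal of R. -/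
namespace LIC

/-- The integral closure `Ī` of an ideal `I`: elements `r` satisfying an equation
`r ^ n + a 1 * r ^ (n-1) + ⋯ + a n = 0` with `a j ∈ I ^ j`. -/
def idealIC {R : Type*} [CommRing R] (I : Ideal R) : Set R :=
  {r | ∃ (n : ℕ) (a : ℕ → R), 0 < n ∧ (∀ j, 1 ≤ j → j ≤ n → a j ∈ I ^ j) ∧
    r ^ n + ∑ j ∈ Finset.Icc 1 n, a j * r ^ (n - j) = 0}

/-- The colon ideal `(I :_R S)` of an ideal `I` and a set `S ⊆ R`. -/
def colonIdeal {R : Type*} [CommRing R] (I : Ideal R) (S : Set R) : Ideal R where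
  carrier := {r | ∀ s ∈ S, r * s ∈ I}
  zero_mem' := by intro s _; simp
  add_mem' := by
    intro a b ha hb s hs
    rw [add_mul]; exact I.add_mem (ha s hs) (hb s hs)
  smul_mem' := by
    intro c r hr s hs
    rw [smul_eq_mul, mul_assoc]; exact I.mul_mem_left c (hr s hs)

/-- The colon submodule `(L :_M J) = {x ∈ M | J • x ⊆ L}`. -/
def colonSubmodule {R : Type*} [CommRing R] {M : Type*} [AddCommGroup M] [Module R M]
    (L : Submodule R M) (J : Ideal R) : Submodule R M where
  carrier := {x | ∀ j ∈ J, j • x ∈ L}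
  zero_mem' := by intro j _; simp
  add_mem' := by
    intro a b ha hb j hj
    rw [smul_add]; exact L.add_mem (ha j hj) (hb j hj)
  smul_mem' := by
    intro c x hx j hj
    rw [smul_comm]; exact L.smul_mem c (hx j hj)

end LIC


namespace LIC

theorem symEmb_single {R : Type*} [CommRing R] {ι : Type*} (i : ι) (r : R) :
    symEmb R ι (Finsupp.single i r) = MvPolynomial.C r * MvPolynomial.X i := by
  simp [symEmb, MvPolynomial.smul_eq_C_mul]

theorem le_freeIC_s8 {R : Type*} [CommRing R] {ι : Type*} (U : Submodule R (ι →₀ R)) :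
    U ≤ freeIC U := by
  intro x hx
  change IsIntegral (Algebra.adjoin R (symEmb R ι '' U)) (symEmb R ι x)
  exact isIntegral_algebraMap
    (x := (⟨symEmb R ι x, Algebra.subset_adjoin ⟨x, hx, rfl⟩⟩ :
      Algebra.adjoin R (symEmb R ι '' U)))

theorem le_lic {R : Type*} [CommRing R] {M : Type*} [AddCommGroup M] [Module R M]
    (L : Submodule R M) : L ≤ lic L := by
  intro x hx
  refine ⟨Finsupp.single x 1, le_freeIC_s8 _ ?_, by simp⟩
  simpa using hx

theorem smul_mem_freeIC {R : Type*} [CommRing R] {ι : Type*} (U V : Submodule R (ι →₀ R))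
    (c : R) (h : ∀ x ∈ U, c • x ∈ V) (x : ι →₀ R) (hx : x ∈ freeIC U) : c • x ∈ freeIC V := by
  let φ : MvPolynomial ι R →ₐ[R] MvPolynomial ι R :=
    MvPolynomial.aeval (fun i => c • MvPolynomial.X i)
  have hφ : ∀ y, φ (symEmb R ι y) = symEmb R ι (c • y) := by
    intro y
    have : φ.toLinearMap ∘ₗ symEmb R ι = c • symEmb R ι := by
      ext i : 2
      simp [symEmb, φ]
    have h2 := LinearMap.congr_fun this y
    simpa using h2
  have hle : Algebra.adjoin R (symEmb R ι '' U) ≤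
      (Algebra.adjoin R (symEmb R ι '' V)).comap φ := by
    refine Algebra.adjoin_le ?_
    rintro _ ⟨y, hy, rfl⟩
    change φ _ ∈ Algebra.adjoin R (symEmb R ι '' V)
    rw [hφ]
    exact Algebra.subset_adjoin ⟨_, h y hy, rfl⟩
  let ψ : Algebra.adjoin R (symEmb R ι '' U) →+* Algebra.adjoin R (symEmb R ι '' V) :=
    ((φ.comp (Algebra.adjoin R (symEmb R ι '' U)).val).codRestrict
      (Algebra.adjoin R (symEmb R ι '' V)) (fun a => hle a.2)).toRingHom
  change IsIntegral (Algebra.adjoin R (symEmb R ι '' V)) (symEmb R ι (c • x))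
  rw [← hφ]
  exact IsIntegral.map_of_comp_eq ψ φ.toRingHom (by ext a; rfl) hx

theorem pow_mem_adjoin {R : Type*} [CommRing R] {S : Type*} [CommRing S] [Algebra R S]
    (A : Subalgebra R S) (I : Ideal R) (X : S)
    (h : ∀ i ∈ I, algebraMap R S i * X ∈ A) (j : ℕ) :
    ∀ a ∈ I ^ j, algebraMap R S a * X ^ j ∈ A := by
  induction j with
  | zero => intro a _; simpa using A.algebraMap_mem a
  | succ k ih =>
    intro a ha
    rw [pow_succ] at ha
    induction ha using Submodule.mul_induction_on' with
    | mem_mul_mem m hm n hn =>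
      have := A.mul_mem (ih m hm) (h n hn)
      convert this using 1
      rw [map_mul]; ring
    | add x _ y _ hx hy =>
      rw [map_add, add_mul]; exact A.add_mem hx hy

theorem isIntegral_of_eq {S : Type*} [CommRing S] {R : Type*} [CommRing R] [Algebra R S]
    (A : Subalgebra R S) (y : S) (n : ℕ) (b : ℕ → S) (hb : ∀ j ∈ Finset.Icc 1 n, b j ∈ A)
    (h : y ^ n + ∑ j ∈ Finset.Icc 1 n, b j * y ^ (n - j) = 0) : IsIntegral A y := by
  classical
  let b' : ℕ → A := fun j => if h : b j ∈ A then ⟨b j, h⟩ else 0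
  refine ⟨Polynomial.X ^ n +
    ∑ j ∈ Finset.Icc 1 n, Polynomial.C (b' j) * Polynomial.X ^ (n - j), ?_, ?_⟩
  · apply Polynomial.monic_X_pow_add
    refine lt_of_le_of_lt (Polynomial.degree_sum_le _ _) ?_
    rw [Finset.sup_lt_iff (by exact WithBot.bot_lt_coe n)]
    intro j hj
    refine lt_of_le_of_lt (Polynomial.degree_C_mul_X_pow_le _ _) ?_
    rw [Finset.mem_Icc] at hj
    exact_mod_cast (by omega : n - j < n)
  · rw [← h]
    simp only [Polynomial.eval₂_add, Polynomial.eval₂_pow, Polynomial.eval₂_X,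
      Polynomial.eval₂_finset_sum, Polynomial.eval₂_mul, Polynomial.eval₂_C]
    congr 1
    refine Finset.sum_congr rfl fun j hj => ?_
    have : algebraMap A S (b' j) = b j := by
      simp only [b', dif_pos (hb j hj)]; rfl
    rw [this]

theorem scaled_eq {R S : Type*} [CommRing R] [CommRing S] [Algebra R S] (X : S) (n : ℕ)
    (a : ℕ → R) (r : R) (h : r ^ n + ∑ j ∈ Finset.Icc 1 n, a j * r ^ (n - j) = 0) :
    (algebraMap R S r * X) ^ n + ∑ j ∈ Finset.Icc 1 n,
      (algebraMap R S (a j) * X ^ j) * (algebraMap R S r * X) ^ (n - j) = 0 := by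
  have h2 := congrArg (fun t => algebraMap R S t * X ^ n) h
  simp only [map_add, map_sum, map_mul, map_pow, map_zero, zero_mul, add_mul,
    Finset.sum_mul] at h2
  rw [← h2, mul_pow]
  congr 1
  refine Finset.sum_congr rfl fun j hj => ?_
  rw [Finset.mem_Icc] at hj
  have : X ^ n = X ^ j * X ^ (n - j) := by
    rw [← pow_add]; congr 1; omega
  rw [mul_pow, this]; ring

end LIC

/-- **Colons.** Over a Noetherian ring, if `L ⊆ M` is liftably integrally
closed (`lic(L,M) = L`), then for every ideal `J` the colon submodule `(L :_M J)` is also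
liftably integrally closed, and for every submodule `U ⊆ M` the colon ideal `(L :_R U)`
is integrally closed as an ideal of `R`. -/
theorem lic_colon {R : Type*} [CommRing R] [IsNoetherianRing R]
    {M : Type*} [AddCommGroup M] [Module R M] (L : Submodule R M)
    (hL : LIC.lic L = L) :
    (∀ J : Ideal R, LIC.lic (LIC.colonSubmodule L J) = LIC.colonSubmodule L J) ∧
    (∀ U : Submodule R M, LIC.idealIC (L.colon U) = (L.colon U : Set R)) := by
  refine ⟨fun J => le_antisymm ?_ (LIC.le_lic _), fun U => Set.Subset.antisymm ?_ ?_⟩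
  · rintro _ ⟨x, hx, rfl⟩ j hj
    rw [← hL, ← map_smul]
    refine ⟨_, LIC.smul_mem_freeIC _ _ j ?_ x hx, rfl⟩
    intro y hy
    have : j • Finsupp.linearCombination R (id : M → M) y ∈ L := hy j hj
    rwa [← map_smul] at this
  · rintro r ⟨n, a, -, ha, h⟩
    change r ∈ L.colon U
    rw [Submodule.mem_colon]
    intro u hu
    rw [← hL]
    refine ⟨Finsupp.single u r, ?_, by simp⟩
    change IsIntegral (Algebra.adjoin R _) (LIC.symEmb R M _)
    rw [LIC.symEmb_single]
    refine LIC.isIntegral_of_eq _ _ n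
      (fun j => algebraMap R _ (a j) * MvPolynomial.X u ^ j) ?_ ?_
    · intro j hj
      rw [Finset.mem_Icc] at hj
      refine LIC.pow_mem_adjoin _ (L.colon U) _ ?_ j _ (ha j hj.1 hj.2)
      intro i hi
      refine Algebra.subset_adjoin ⟨Finsupp.single u i, ?_, LIC.symEmb_single u i⟩
      have := Submodule.mem_colon.1 hi u hu
      simpa using this
    · exact LIC.scaled_eq _ n a r h
  · intro r hr
    refine ⟨1, fun _ => -r, one_pos, ?_, by simp⟩
    intro j h1 h2
    obtain rfl : j = 1 := by omega
    rw [pow_one]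
    exact neg_mem hr
end

section
/- (Nakayama property.) Let (R,m) be a Noetherian local ring and L ⊆ M R-modules such that M/L is finitely generated. Then lic(L,M) ⊆ L + mM. Consequently, lic(L,M) = M if and only if L = M. -/
theorem lic_aux_functional {R : Type*} [CommRing R] [IsLocalRing R]
    {M : Type*} [AddCommGroup M] [Module R M] (L : Submodule R M) (z : M)
    (hz : z ∉ L ⊔ (IsLocalRing.maximalIdeal R) • (⊤ : Submodule R M)) :
    ∃ f : M →ₗ[R] IsLocalRing.ResidueField R, (∀ y ∈ L, f y = 0) ∧ f z ≠ 0 := by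
  set I := IsLocalRing.maximalIdeal R with hI
  let _ : Field (R ⧸ I) := Ideal.Quotient.field I
  let N := (M ⧸ L) ⧸ (I • (⊤ : Submodule R (M ⧸ L)))
  let q : M →ₗ[R] N := (I • (⊤ : Submodule R (M ⧸ L))).mkQ ∘ₗ L.mkQ
  have hq : q z ≠ 0 := by
    intro h
    apply hz
    have h1 : L.mkQ z ∈ I • (⊤ : Submodule R (M ⧸ L)) := by
      exact (Submodule.Quotient.mk_eq_zero _).1 h
    have h2 : (I • (⊤ : Submodule R (M ⧸ L))) = (I • (⊤ : Submodule R M)).map L.mkQ := by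
      rw [Submodule.map_smul'', Submodule.map_top, Submodule.range_mkQ]
    rw [h2, ← Submodule.mem_comap, Submodule.comap_map_mkQ] at h1
    exact h1
  have h3 : ∃ g : Module.Dual (R ⧸ I) N, g (q z) ≠ 0 := by
    by_contra! hcon
    exact hq ((Module.forall_dual_apply_eq_zero_iff (R ⧸ I) (q z)).1 hcon)
  obtain ⟨g, hg⟩ := h3
  refine ⟨(g.restrictScalars R : N →ₗ[R] (R ⧸ I)) ∘ₗ q, fun y hy => ?_, hg⟩
  have : q y = 0 := by
    have : L.mkQ y = 0 := by simpa using hy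
    simp only [q, LinearMap.comp_apply, this, map_zero]
  change g (q y) = 0
  rw [this, map_zero]

theorem lic_aux_le {R : Type*} [CommRing R] [IsLocalRing R]
    {M : Type*} [AddCommGroup M] [Module R M] (L : Submodule R M) :
    LIC.lic L ≤ L ⊔ (IsLocalRing.maximalIdeal R) • (⊤ : Submodule R M) := by
  rintro _ ⟨x, hx, rfl⟩
  by_contra hz
  obtain ⟨f, hfL, hfz⟩ := lic_aux_functional L _ hz
  let k := IsLocalRing.ResidueField R
  let ev : MvPolynomial M R →ₐ[R] Polynomial k :=
    MvPolynomial.aeval (fun m => Polynomial.C (f m) * Polynomial.X)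
  have hev : ∀ y : M →₀ R, ev (LIC.symEmb R M y) =
      Polynomial.C (f (Finsupp.linearCombination R (id : M → M) y)) * Polynomial.X := by
    intro y
    induction y using Finsupp.induction_linear with
    | zero => simp
    | add a b ha hb => simp only [map_add, ha, hb, add_mul]
    | single m r =>
      simp [LIC.symEmb, ev, Algebra.smul_def, mul_assoc, Polynomial.algebraMap_apply]
      exact Or.inl rfl
  let K := Submodule.comap (Finsupp.linearCombination R (id : M → M)) L
  let A := Algebra.adjoin R (LIC.symEmb R M '' (K : Set (M →₀ R)))
  let e0 : Polynomial k →ₐ[R] k := (Polynomial.aeval (0 : k)).restrictScalars R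
  let c : k →ₐ[R] Polynomial k := (Algebra.ofId k (Polynomial k)).restrictScalars R
  have hA : A ≤ AlgHom.equalizer (c.comp (e0.comp ev)) ev := by
    refine Algebra.adjoin_le ?_
    rintro _ ⟨y, hy, rfl⟩
    have h0 : ev (LIC.symEmb R M y) = 0 := by
      rw [hev, hfL _ hy]; simp
    change c (e0 (ev (LIC.symEmb R M y))) = ev (LIC.symEmb R M y)
    rw [h0, map_zero, map_zero]
  have hint : IsIntegral A (LIC.symEmb R M x) := hx
  have hint2 : IsIntegral k (ev (LIC.symEmb R M x)) := by
    refine IsIntegral.map_of_comp_eq (e0.comp (ev.comp A.val)).toRingHom ev.toRingHom ?_ hint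
    ext1 a
    exact hA a.2
  rw [hev] at hint2
  have hX : IsIntegral k (Polynomial.X : Polynomial k) := by
    have := (isIntegral_algebraMap (R := k) (A := Polynomial k)
      (x := (f (Finsupp.linearCombination R (id : M → M) x))⁻¹)).mul hint2
    rwa [Polynomial.algebraMap_eq, ← mul_assoc, ← Polynomial.C_mul, inv_mul_cancel₀ hfz,
      Polynomial.C_1, one_mul] at this
  exact Polynomial.transcendental_X k hX.isAlgebraic

/-- **Nakayama property.** If `(R,m)` is Noetherian local and `M/L` is a
finitely generated module, then `lic(L,M) ⊆ L + mM`; consequently `lic(L,M) = M` iff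
`L = M`. -/
theorem lic_le_sup_smul_top {R : Type*} [CommRing R] [IsLocalRing R] [IsNoetherianRing R]
    {M : Type*} [AddCommGroup M] [Module R M] (L : Submodule R M)
    (hfg : Module.Finite R (M ⧸ L)) :
    LIC.lic L ≤ L ⊔ (IsLocalRing.maximalIdeal R) • (⊤ : Submodule R M) ∧
      (LIC.lic L = ⊤ ↔ L = ⊤) := by
  refine ⟨lic_aux_le L, fun h => ?_, ?_⟩
  · have h1 := lic_aux_le L
    rw [h, top_le_iff] at h1
    have h2 : (⊤ : Submodule R (M ⧸ L)) ≤
        IsLocalRing.maximalIdeal R • (⊤ : Submodule R (M ⧸ L)) := by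
      have := congrArg (Submodule.map L.mkQ) h1
      rw [Submodule.map_sup, Submodule.map_smul'', Submodule.map_top, Submodule.range_mkQ,
        Submodule.mkQ_map_self, bot_sup_eq] at this
      exact this.ge
    have h3 := Submodule.eq_bot_of_le_smul_of_le_jacobson_bot _ _ hfg.fg_top h2
      (IsLocalRing.maximalIdeal_le_jacobson _)
    rw [eq_top_iff]
    intro y _
    have : L.mkQ y ∈ (⊤ : Submodule R (M ⧸ L)) := trivial
    rw [h3] at this
    simpa using this
  · rintro rfl
    rw [eq_top_iff]
    intro y _
    refine ⟨Finsupp.single y 1, ?_, by simp⟩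
    change IsIntegral (Algebra.adjoin R _) (LIC.symEmb R M (Finsupp.single y 1))
    have hmem : LIC.symEmb R M (Finsupp.single y 1) ∈ Algebra.adjoin R (LIC.symEmb R M ''
        (Submodule.comap (Finsupp.linearCombination R (id : M → M)) ⊤ : Submodule R (M →₀ R))) :=
      Algebra.subset_adjoin ⟨Finsupp.single y 1, trivial, rfl⟩
    exact isIntegral_algebraMap (x := (⟨_, hmem⟩ : Algebra.adjoin R _))
end
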